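/- (Riesz rearrangement inequality in one dimension) For nonnegative measurable functions f₁, f₂, f₃ on ℝ with symmetric decreasing rearrangements f₁*, f₂*, f₃*, one has ∬_{ℝ²} f₁(x) f₂(x−y) f₃(y) dx dy ≤ ∬_{ℝ²} f₁*(x) f₂*(x−y) f₃*(y) dx dy. -/

import Mathlib

open Set MeasureTheory

/-- A finite measure on `ℝ` is the image of Lebesgue measure on an interval under its monotone
quantile function. -/
theorem exists_monotoneOn_map_restrict_Ioo (μ : Measure ℝ) [IsFiniteMeasure μ] :
    ∃ α : ℝ → ℝ, Measurable α ∧ MonotoneOn α (Ioo 0 (μ univ).toReal) ∧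
      (volume.restrict (Ioo 0 (μ univ).toReal)).map α = μ := by
  classical
  set a := (μ univ).toReal with ha
  let S : ℝ → Set ℝ := fun s => {x | ENNReal.ofReal s ≤ μ (Iic x)}
  have hne : ∀ s ∈ Ioo 0 a, (S s).Nonempty := by
    intro s hs
    have h1 : ENNReal.ofReal s < μ univ := by
      rw [ENNReal.ofReal_lt_iff_lt_toReal hs.1.le (measure_ne_top _ _)]; exact hs.2
    obtain ⟨x, hx⟩ := ((tendsto_measure_Iic_atTop μ).eventually (lt_mem_nhds h1)).exists
    exact ⟨x, hx.le⟩
  have hbdd : ∀ s ∈ Ioo 0 a, BddBelow (S s) := by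
    intro s hs
    have h0 : (0 : ENNReal) < ENNReal.ofReal s := by simpa using hs.1
    have htop : Filter.Tendsto (fun x => μ (Iic x)) Filter.atBot (nhds 0) := by
      have h := tendsto_measure_iInter_atBot (μ := μ) (s := fun x : ℝ => Iic x)
        (fun _ => measurableSet_Iic.nullMeasurableSet) (fun i j hij => Iic_subset_Iic.2 hij)
        ⟨0, measure_ne_top _ _⟩
      rwa [iInter_Iic_eq_empty_iff.2 (by simp), measure_empty] at h
    obtain ⟨x, hx⟩ := (htop.eventually (gt_mem_nhds h0)).exists
    refine ⟨x, fun y hy => ?_⟩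
    by_contra! h
    exact absurd (hy.trans (measure_mono (Iic_subset_Iic.2 h.le))) (not_le.2 hx)
  have hmem : ∀ s ∈ Ioo 0 a, sInf (S s) ∈ S s := by
    intro s hs
    have h1 := tendsto_measure_biInter_gt (μ := μ) (s := fun x : ℝ => Iic x) (a := sInf (S s))
      (fun r _ => measurableSet_Iic.nullMeasurableSet)
      (fun i j _ hij => Iic_subset_Iic.2 hij) ⟨sInf (S s) + 1, by simp, measure_ne_top _ _⟩
    have h2 : (⋂ r > sInf (S s), Iic r) = Iic (sInf (S s)) := by
      ext x
      simp only [mem_iInter, mem_Iic]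
      exact ⟨fun h => le_of_forall_gt_imp_ge_of_dense h, fun h r hr => h.trans hr.le⟩
    rw [h2] at h1
    refine ge_of_tendsto h1 ?_
    filter_upwards [self_mem_nhdsWithin] with x hx
    obtain ⟨y, hy, hyx⟩ := exists_lt_of_csInf_lt (hne s hs) hx
    exact (show ENNReal.ofReal s ≤ μ (Iic y) from hy).trans (measure_mono (Iic_subset_Iic.2 hyx.le))
  have hgal : ∀ s ∈ Ioo 0 a, ∀ x, sInf (S s) ≤ x ↔ s ≤ (μ (Iic x)).toReal := by
    intro s hs x
    rw [← ENNReal.ofReal_le_iff_le_toReal (measure_ne_top _ _)]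
    exact ⟨fun h => (show ENNReal.ofReal s ≤ _ from hmem s hs).trans
      (measure_mono (Iic_subset_Iic.2 h)), fun h => csInf_le (hbdd s hs) h⟩
  let α : ℝ → ℝ := (Ioo 0 a).piecewise (fun s => sInf (S s)) 0
  have hα : ∀ s ∈ Ioo 0 a, α s = sInf (S s) := fun s hs => piecewise_eq_of_mem _ _ _ hs
  have hpre : ∀ x, α ⁻¹' Iic x ∩ Ioo 0 a = Iic (μ (Iic x)).toReal ∩ Ioo 0 a := by
    intro x
    ext s
    simp only [mem_inter_iff, mem_preimage, mem_Iic, and_congr_left_iff]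
    intro hs
    rw [hα s hs, hgal s hs]
  have hαm : Measurable α := by
    refine measurable_of_Iic fun x => ?_
    have : α ⁻¹' Iic x = (Iic (μ (Iic x)).toReal ∩ Ioo 0 a) ∪ ({s | (0 : ℝ) ≤ x} ∩ (Ioo 0 a)ᶜ) := by
      rw [← hpre x]
      ext s
      by_cases hs : s ∈ Ioo 0 a
      · simp only [mem_union, mem_inter_iff, hs, mem_compl_iff]; simp
      · simp only [mem_union, mem_inter_iff, hs, mem_compl_iff]; simp [α, hs]
    rw [this]
    measurability
  refine ⟨α, hαm, fun s hs r hr hsr => ?_, ?_⟩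
  · rw [hα s hs, hα r hr]
    exact csInf_le (hbdd s hs) ((ENNReal.ofReal_le_ofReal hsr).trans (hmem r hr))
  · refine Measure.ext_of_Iic _ _ fun x => ?_
    rw [Measure.map_apply hαm measurableSet_Iic,
      Measure.restrict_apply (hαm measurableSet_Iic), hpre x]
    have hle : (μ (Iic x)).toReal ≤ a :=
      ENNReal.toReal_mono (measure_ne_top _ _) (measure_mono (subset_univ _))
    apply le_antisymm
    · calc _ ≤ volume (Ioc 0 (μ (Iic x)).toReal) :=
            measure_mono fun s hs => ⟨hs.2.1, hs.1⟩
        _ = _ := by simp [measure_ne_top]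
    · calc μ (Iic x) = volume (Ioo 0 (μ (Iic x)).toReal) := by simp [measure_ne_top]
        _ ≤ volume (Iic (μ (Iic x)).toReal ∩ Ioo 0 a) :=
            measure_mono fun s hs => ⟨hs.2.le, hs.1, hs.2.trans_le hle⟩

/-- The part of `B × C` where the sum of the coordinates lies in `A`. -/
def sumSet (A B C : Set ℝ) : Set (ℝ × ℝ) := B ×ˢ C ∩ (fun p => p.1 + p.2) ⁻¹' A

theorem measurableSet_sumSet {A B C : Set ℝ} (hA : MeasurableSet A) (hB : MeasurableSet B)
    (hC : MeasurableSet C) : MeasurableSet (sumSet A B C) :=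
  (hB.prod hC).inter (measurable_fst.add measurable_snd hA)

theorem volume_sumSet_comm (A B C : Set ℝ) (hA : MeasurableSet A) (hB : MeasurableSet B)
    (hC : MeasurableSet C) : volume (sumSet A B C) = volume (sumSet A C B) := by
  have h := (Measure.measurePreserving_swap (μ := (volume : Measure ℝ))
    (ν := (volume : Measure ℝ))).measure_preimage (s := sumSet A B C)
    (measurableSet_sumSet hA hB hC).nullMeasurableSet
  rw [Measure.volume_eq_prod, ← h]
  congr 1
  ext p
  simp [sumSet, add_comm, and_comm]

/-- A continuous analogue of Pollard's theorem. In quantile coordinates, increasing on `B` and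
decreasing on `C`, the product `B × C` splits into a rectangle and a family of hooks along each of
which the sums `x + y` cover `A` at most once. -/
theorem volume_sumSet_le (A B C : Set ℝ) (hA : MeasurableSet A)
    (hBf : volume B ≠ ⊤) (hCf : volume C ≠ ⊤) (t : ℝ)
    (htB : t ≤ (volume B).toReal) (htC : t ≤ (volume C).toReal) :
    volume (sumSet A B C) ≤ ENNReal.ofReal ((volume B).toReal - t) *
      ENNReal.ofReal ((volume C).toReal - t) + volume A * ENNReal.ofReal t := by
  have : IsFiniteMeasure (volume.restrict B) := ⟨by simpa using hBf.lt_top⟩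
  have : IsFiniteMeasure (volume.restrict C) := ⟨by simpa using hCf.lt_top⟩
  have : IsFiniteMeasure ((volume.restrict C).map Neg.neg) := inferInstance
  obtain ⟨α, hα, hαmono, hαmap⟩ := exists_monotoneOn_map_restrict_Ioo (volume.restrict B)
  obtain ⟨γ, hγ, hγmono, hγmap⟩ :=
    exists_monotoneOn_map_restrict_Ioo ((volume.restrict C).map Neg.neg)
  rw [Measure.map_apply measurable_neg MeasurableSet.univ, preimage_univ] at hγmono hγmap
  simp only [Measure.restrict_apply MeasurableSet.univ, univ_inter] at hαmono hαmap hγmono hγmap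
  set b := (volume B).toReal with hb
  set c := (volume C).toReal with hc
  set β : ℝ → ℝ := fun s => - γ s with hβdef
  have hβ : Measurable β := hγ.neg
  have hβmono : AntitoneOn β (Ioo 0 c) := fun s hs r hr h => neg_le_neg (hγmono hs hr h)
  have hβmap : (volume.restrict (Ioo 0 c)).map β = volume.restrict C := by
    have : β = Neg.neg ∘ γ := rfl
    rw [this, ← Measure.map_map measurable_neg hγ, hγmap,
      Measure.map_map measurable_neg measurable_neg]
    simp
  have hadd : Measurable fun p : ℝ × ℝ => p.1 + p.2 := measurable_fst.add measurable_snd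
  set ν := (volume.restrict (Ioo 0 b)).prod (volume.restrict (Ioo 0 c)) with hν
  set E : Set (ℝ × ℝ) := {p | α p.1 + β p.2 ∈ A} with hE
  have hαβ : Measurable fun p : ℝ × ℝ => α p.1 + β p.2 :=
    (hα.comp measurable_fst).add (hβ.comp measurable_snd)
  have hEm : MeasurableSet E := hαβ hA
  have h1 : volume (sumSet A B C) = ν E := by
    rw [sumSet, inter_comm, ← Measure.restrict_apply (hadd hA), Measure.volume_eq_prod,
      ← Measure.prod_restrict, ← hαmap, ← hβmap, Measure.map_prod_map _ _ hα hβ,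
      Measure.map_apply (by fun_prop) (hadd hA)]
    rfl
  set R₁ : Set (ℝ × ℝ) := {p | p.1 < t ∧ p.1 ≤ p.2}
  set R₂ : Set (ℝ × ℝ) := {p | p.2 < t ∧ p.2 ≤ p.1}
  have hR₁ : MeasurableSet R₁ :=
    (measurableSet_lt measurable_fst measurable_const).inter
      (measurableSet_le measurable_fst measurable_snd)
  have hR₂ : MeasurableSet R₂ :=
    (measurableSet_lt measurable_snd measurable_const).inter
      (measurableSet_le measurable_snd measurable_fst)
  have hcover : E ⊆ ((Ici t ×ˢ Ici t) ∪ (E ∩ R₁)) ∪ (E ∩ R₂) := by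
    intro p hp
    simp only [mem_union, mem_inter_iff, mem_prod, mem_Ici, hp, true_and, R₁, R₂, mem_ofPred_eq]
    by_contra! h
    rcases le_total p.1 p.2 with h' | h'
    · by_cases h2 : p.1 < t
      · linarith [h.1.2 h2]
      · push Not at h2
        linarith [h.1.1 h2]
    · by_cases h2 : p.2 < t
      · linarith [h.2 h2]
      · push Not at h2
        linarith [h.1.1 (h2.trans h')]
  have hIci : ∀ d, t ≤ d → volume.restrict (Ioo 0 d) (Ici t) ≤ ENNReal.ofReal (d - t) := by
    intro d hd
    rw [Measure.restrict_apply measurableSet_Ici]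
    calc _ ≤ volume (Ico t d) := measure_mono fun x hx => ⟨hx.1, hx.2.2⟩
      _ = _ := by simp
  have hrect : ν (Ici t ×ˢ Ici t) ≤ ENNReal.ofReal (b - t) * ENNReal.ofReal (c - t) := by
    rw [hν, Measure.prod_prod]
    exact mul_le_mul' (hIci b htB) (hIci c htC)
  have hreg₁ : ν (E ∩ R₁) ≤ ∫⁻ s in Ioo 0 t, volume (A ∩ Iic (α s + β s)) := by
    rw [hν, Measure.prod_apply (hEm.inter hR₁), ← lintegral_indicator measurableSet_Ioo,
      ← lintegral_indicator measurableSet_Ioo]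
    refine lintegral_mono fun s => ?_
    by_cases hs : s ∈ Ioo 0 b
    swap
    · simp [indicator_of_notMem hs]
    rw [indicator_of_mem hs]
    by_cases hst : s < t
    swap
    · have : Prod.mk s ⁻¹' (E ∩ R₁) = ∅ := by
        ext r; simp [R₁, hst]
      simp [this]
    rw [indicator_of_mem (show s ∈ Ioo 0 t from ⟨hs.1, hst⟩)]
    have hmeas : MeasurableSet (A ∩ Iic (α s + β s)) := hA.inter measurableSet_Iic
    calc volume.restrict (Ioo 0 c) (Prod.mk s ⁻¹' (E ∩ R₁))
        ≤ volume.restrict (Ioo 0 c) (β ⁻¹' ((fun y => α s + y) ⁻¹' (A ∩ Iic (α s + β s)))) := by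
          rw [Measure.restrict_apply' measurableSet_Ioo, Measure.restrict_apply' measurableSet_Ioo]
          refine measure_mono fun r hr => ⟨⟨hr.1.1, ?_⟩, hr.2⟩
          have := hβmono ⟨hs.1, hst.trans_le htC⟩ hr.2 hr.1.2.2
          simpa using this
      _ = volume.restrict C ((fun y => α s + y) ⁻¹' (A ∩ Iic (α s + β s))) := by
          rw [← hβmap, Measure.map_apply hβ (measurable_const_add _ hmeas)]
      _ ≤ volume ((fun y => α s + y) ⁻¹' (A ∩ Iic (α s + β s))) := Measure.restrict_apply_le _ _
      _ = _ := measure_preimage_add _ _ _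
  have hreg₂ : ν (E ∩ R₂) ≤ ∫⁻ s in Ioo 0 t, volume (A ∩ Ici (α s + β s)) := by
    rw [hν, Measure.prod_apply_symm (hEm.inter hR₂), ← lintegral_indicator measurableSet_Ioo,
      ← lintegral_indicator measurableSet_Ioo]
    refine lintegral_mono fun s => ?_
    by_cases hs : s ∈ Ioo 0 c
    swap
    · simp [indicator_of_notMem hs]
    rw [indicator_of_mem hs]
    by_cases hst : s < t
    swap
    · have : (fun x => (x, s)) ⁻¹' (E ∩ R₂) = ∅ := by
        ext r; simp [R₂, hst]
      simp [this]
    rw [indicator_of_mem (show s ∈ Ioo 0 t from ⟨hs.1, hst⟩)]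
    have hmeas : MeasurableSet (A ∩ Ici (α s + β s)) := hA.inter measurableSet_Ici
    calc volume.restrict (Ioo 0 b) ((fun x => (x, s)) ⁻¹' (E ∩ R₂))
        ≤ volume.restrict (Ioo 0 b) (α ⁻¹' ((fun y => y + β s) ⁻¹' (A ∩ Ici (α s + β s)))) := by
          rw [Measure.restrict_apply' measurableSet_Ioo, Measure.restrict_apply' measurableSet_Ioo]
          refine measure_mono fun r hr => ⟨⟨hr.1.1, ?_⟩, hr.2⟩
          have := hαmono ⟨hs.1, hst.trans_le htB⟩ hr.2 hr.1.2.2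
          simpa using this
      _ = volume.restrict B ((fun y => y + β s) ⁻¹' (A ∩ Ici (α s + β s))) := by
          rw [← hαmap, Measure.map_apply hα (measurable_add_const _ hmeas)]
      _ ≤ volume ((fun y => y + β s) ⁻¹' (A ∩ Ici (α s + β s))) := Measure.restrict_apply_le _ _
      _ = _ := measure_preimage_add_right _ _ _
  have hsplit : ∀ x : ℝ, volume (A ∩ Iic x) + volume (A ∩ Ici x) = volume A := by
    intro x
    rw [← measure_inter_add_sdiff A (measurableSet_Iic (a := x)), sdiff_eq, compl_Iic]
    congr 1
    exact measure_congr ((Filter.EventuallyEq.refl _ _).inter Ioi_ae_eq_Ici.symm)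
  calc volume (sumSet A B C) = ν E := h1
    _ ≤ ν (Ici t ×ˢ Ici t) + ν (E ∩ R₁) + ν (E ∩ R₂) :=
        (measure_mono hcover).trans ((measure_union_le _ _).trans
          (add_le_add_left (measure_union_le _ _) _))
    _ ≤ ENNReal.ofReal (b - t) * ENNReal.ofReal (c - t) +
        (∫⁻ s in Ioo 0 t, volume (A ∩ Iic (α s + β s))) +
        ∫⁻ s in Ioo 0 t, volume (A ∩ Ici (α s + β s)) := by gcongr
    _ ≤ ENNReal.ofReal (b - t) * ENNReal.ofReal (c - t) +
        ∫⁻ s in Ioo 0 t, volume A := by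
        rw [add_assoc]
        gcongr
        refine (le_lintegral_add _ _).trans_eq ?_
        simp only [hsplit]
    _ = _ := by simp

/-- The open interval of length `a` centred at the origin. -/
def centredIoo (a : ℝ) : Set ℝ := Ioo (-(a / 2)) (a / 2)

theorem measurableSet_centredIoo (a : ℝ) : MeasurableSet (centredIoo a) := measurableSet_Ioo

theorem volume_centredIoo (a : ℝ) : volume (centredIoo a) = ENNReal.ofReal a := by
  simp [centredIoo]

theorem le_volume_sumSet_centredIoo_of_add_le {a b c : ℝ} (h : a + b ≤ c) :
    ENNReal.ofReal a * ENNReal.ofReal b ≤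
      volume (sumSet (centredIoo a) (centredIoo b) (centredIoo c)) := by
  rw [Measure.volume_eq_prod, Measure.prod_apply (measurableSet_sumSet (measurableSet_centredIoo _)
    (measurableSet_centredIoo _) (measurableSet_centredIoo _))]
  calc ENNReal.ofReal a * ENNReal.ofReal b = ∫⁻ _ in centredIoo b, ENNReal.ofReal a := by
        simp [volume_centredIoo]
    _ ≤ _ := by
        refine (setLIntegral_mono' (measurableSet_centredIoo b) fun x hx => ?_).trans
          (setLIntegral_le_lintegral _ _)
        calc ENNReal.ofReal a = volume (Ioo (-(a / 2) - x) (a / 2 - x)) := by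
              rw [Real.volume_Ioo]; congr 1; ring
          _ ≤ _ := measure_mono fun y hy => by
              simp only [centredIoo, mem_Ioo] at hx hy
              simp only [sumSet, centredIoo, mem_preimage, mem_inter_iff, mem_prod, mem_Ioo]
              refine ⟨⟨hx, ?_, ?_⟩, ?_, ?_⟩ <;> linarith

theorem le_volume_sumSet_centredIoo_of_le {a b c : ℝ} (h : b + c ≤ a) :
    ENNReal.ofReal b * ENNReal.ofReal c ≤
      volume (sumSet (centredIoo a) (centredIoo b) (centredIoo c)) := by
  rw [← volume_centredIoo b, ← volume_centredIoo c, ← Measure.prod_prod, ← Measure.volume_eq_prod]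
  refine measure_mono fun p hp => ⟨hp, ?_⟩
  simp only [centredIoo, mem_prod, mem_Ioo] at hp
  simp only [centredIoo, mem_preimage, mem_Ioo]
  constructor <;> linarith

theorem integral_max_add_sub_zero {c t : ℝ} (ht : 0 ≤ t) (htc : t ≤ c) :
    ∫ y in (-(c / 2))..(c / 2), max (y + (t - c / 2)) 0 = t ^ 2 / 2 := by
  have hc : Continuous fun y : ℝ => max (y + (t - c / 2)) 0 := by fun_prop
  rw [← intervalIntegral.integral_add_adjacent_intervals (b := c / 2 - t)
    (hc.intervalIntegrable _ _) (hc.intervalIntegrable _ _)]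
  have h1 : ∫ y in (-(c / 2))..(c / 2 - t), max (y + (t - c / 2)) 0 =
      ∫ y in (-(c / 2))..(c / 2 - t), (0 : ℝ) := by
    refine intervalIntegral.integral_congr fun y hy => ?_
    rw [uIcc_of_le (by linarith)] at hy
    exact max_eq_right (by linarith [hy.2])
  have h2 : ∫ y in (c / 2 - t)..(c / 2), max (y + (t - c / 2)) 0 =
      ∫ y in (c / 2 - t)..(c / 2), (y + (t - c / 2)) := by
    refine intervalIntegral.integral_congr fun y hy => ?_
    rw [uIcc_of_le (by linarith)] at hy
    exact max_eq_left (by linarith [hy.1])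
  rw [h1, h2, intervalIntegral.integral_add (by simp) (by simp)]
  simp
  ring

theorem le_volume_sumSet_centredIoo {b c t : ℝ} (ht : 0 ≤ t) (htc : t ≤ c) :
    ENNReal.ofReal (b * c - t ^ 2) ≤
      volume (sumSet (centredIoo (b + c - 2 * t)) (centredIoo b) (centredIoo c)) := by
  rw [Measure.volume_eq_prod, Measure.prod_apply_symm (measurableSet_sumSet
    (measurableSet_centredIoo _) (measurableSet_centredIoo _) (measurableSet_centredIoo _))]
  set g : ℝ → ℝ := fun y => b - max (y + (t - c / 2)) 0 - max (-y + (t - c / 2)) 0 with hg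
  have hgc : Continuous g := by fun_prop
  have hint : ∫ y in (-(c / 2))..(c / 2), g y = b * c - t ^ 2 := by
    have h1 := integral_max_add_sub_zero ht htc
    have h2 : ∫ y in (-(c / 2))..(c / 2), max (-y + (t - c / 2)) 0 = t ^ 2 / 2 := by
      rw [intervalIntegral.integral_comp_neg fun y => max (y + (t - c / 2)) 0, neg_neg, h1]
    rw [hg, intervalIntegral.integral_sub, intervalIntegral.integral_sub, h1, h2]
    · simp
      ring
    all_goals exact Continuous.intervalIntegrable (by fun_prop) _ _
  rw [← hint, intervalIntegral.integral_of_le (by linarith), integral_Ioc_eq_integral_Ioo]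
  calc ENNReal.ofReal (∫ y in Ioo (-(c / 2)) (c / 2), g y)
      ≤ ENNReal.ofReal (∫ y in Ioo (-(c / 2)) (c / 2), max (g y) 0) := by
        have hi : ∀ f : ℝ → ℝ, Continuous f → IntegrableOn f (Ioo (-(c / 2)) (c / 2)) :=
          fun f hf => (hf.integrableOn_Icc).mono_set Ioo_subset_Icc_self
        exact ENNReal.ofReal_le_ofReal (integral_mono (hi _ hgc) (hi _ (by fun_prop))
          fun y => le_max_left _ _)
    _ = ∫⁻ y in Ioo (-(c / 2)) (c / 2), ENNReal.ofReal (g y) := by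
        rw [ofReal_integral_eq_lintegral_ofReal]
        · simp [ENNReal.ofReal_max]
        · exact ((hgc.max continuous_const).integrableOn_Icc).mono_set Ioo_subset_Icc_self
        · exact Filter.Eventually.of_forall fun y => le_max_right _ _
    _ ≤ _ := by
        refine (setLIntegral_mono' measurableSet_Ioo fun y hy => ?_).trans
          (setLIntegral_le_lintegral _ _)
        calc ENNReal.ofReal (g y) ≤ volume (Ioo (-(b / 2) + max (-y + (t - c / 2)) 0)
                (b / 2 - max (y + (t - c / 2)) 0)) := by
              rw [Real.volume_Ioo]; apply le_of_eq; congr 1; simp only [hg]; ring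
          _ ≤ _ := measure_mono fun x hx => by
              simp only [mem_Ioo] at hx hy
              simp only [sumSet, centredIoo, mem_preimage, mem_inter_iff, mem_prod, mem_Ioo]
              have h1 := le_max_left (y + (t - c / 2)) 0
              have h2 := le_max_right (y + (t - c / 2)) 0
              have h3 := le_max_left (-y + (t - c / 2)) 0
              have h4 := le_max_right (-y + (t - c / 2)) 0
              refine ⟨⟨⟨?_, ?_⟩, hy⟩, ?_, ?_⟩ <;> linarith

theorem volume_sumSet_le_centredIoo {A B C : Set ℝ} (hA : MeasurableSet A)
    (hAf : volume A ≠ ⊤) (hBf : volume B ≠ ⊤) (hCf : volume C ≠ ⊤) :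
    volume (sumSet A B C) ≤ volume (sumSet (centredIoo (volume A).toReal)
      (centredIoo (volume B).toReal) (centredIoo (volume C).toReal)) := by
  have key := volume_sumSet_le A B C hA hBf hCf
  rw [← ENNReal.ofReal_toReal hAf] at key
  have ha : 0 ≤ (volume A).toReal := ENNReal.toReal_nonneg
  have hb : 0 ≤ (volume B).toReal := ENNReal.toReal_nonneg
  have hc : 0 ≤ (volume C).toReal := ENNReal.toReal_nonneg
  generalize (volume A).toReal = a at *
  generalize (volume B).toReal = b at *
  generalize (volume C).toReal = c at *
  rcases le_total (b + c) a with h | h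
  · refine (key 0 hb hc).trans ?_
    simpa using le_volume_sumSet_centredIoo_of_le h
  rcases le_total (a + b) c with h' | h'
  · refine (key b le_rfl (by linarith)).trans ?_
    simpa using le_volume_sumSet_centredIoo_of_add_le h'
  rcases le_total (a + c) b with h'' | h''
  · refine (key c (by linarith) le_rfl).trans ?_
    rw [volume_sumSet_comm _ _ _ (measurableSet_centredIoo a) (measurableSet_centredIoo b)
      (measurableSet_centredIoo c)]
    simpa using le_volume_sumSet_centredIoo_of_add_le h''
  · refine (key ((b + c - a) / 2) (by linarith) (by linarith)).trans ?_
    have := le_volume_sumSet_centredIoo (b := b) (c := c) (t := (b + c - a) / 2)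
      (by linarith) (by linarith)
    rw [show b + c - 2 * ((b + c - a) / 2) = a by ring] at this
    refine le_trans (le_of_eq ?_) this
    rw [← ENNReal.ofReal_mul (by linarith), ← ENNReal.ofReal_mul ha, ← ENNReal.ofReal_add]
    · congr 1; ring
    · exact mul_nonneg (by linarith) (by linarith)
    · exact mul_nonneg ha (by linarith)

theorem centredIoo_subset {S : Set ℝ} (hS : ∀ x ∈ S, ∀ y, |y| ≤ |x| → y ∈ S) {a : ℝ}
    (ha : ENNReal.ofReal a ≤ volume S) : centredIoo a ⊆ S := by
  intro x hx
  by_contra hxS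
  have hx' : |x| < a / 2 := abs_lt.2 hx
  have hsub : S ⊆ Ioo (-|x|) |x| := fun y hy => abs_lt.1 <| by
    by_contra! h
    exact hxS (hS y hy x h)
  have h := ha.trans (measure_mono hsub)
  rw [Real.volume_Ioo, ENNReal.ofReal_le_ofReal_iff (by linarith [abs_nonneg x])] at h
  linarith

theorem sumSet_mono {A A' B B' C C' : Set ℝ} (hA : A ⊆ A') (hB : B ⊆ B') (hC : C ⊆ C') :
    sumSet A B C ⊆ sumSet A' B' C' :=
  inter_subset_inter (prod_mono hB hC) (preimage_mono hA)

/-- The Riesz rearrangement inequality for sets. -/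
theorem volume_sumSet_le_of_symmetric {A B C A' B' C' : Set ℝ} (hA : MeasurableSet A)
    (hA' : ∀ x ∈ A', ∀ y, |y| ≤ |x| → y ∈ A') (hB' : ∀ x ∈ B', ∀ y, |y| ≤ |x| → y ∈ B')
    (hC' : ∀ x ∈ C', ∀ y, |y| ≤ |x| → y ∈ C') (hAA' : volume A ≤ volume A')
    (hBB' : volume B ≤ volume B') (hCC' : volume C ≤ volume C') :
    volume (sumSet A B C) ≤ volume (sumSet A' B' C') := by
  let K : ℕ → Set ℝ := fun n => Icc (-(n : ℝ)) n
  have hK : Monotone K := fun m n h =>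
    have h' : (m : ℝ) ≤ n := by exact_mod_cast h
    Icc_subset_Icc (neg_le_neg h') h'
  have hKm : ∀ n, MeasurableSet (K n) := fun _ => measurableSet_Icc
  have hKf : ∀ S n, volume (S ∩ K n) ≠ ⊤ := fun S n =>
    ((measure_mono inter_subset_right).trans_lt (by simp [K])).ne
  have hU : sumSet A B C = ⋃ n, sumSet (A ∩ K n) (B ∩ K n) (C ∩ K n) := by
    refine Subset.antisymm (fun p hp => ?_) (iUnion_subset fun n =>
      sumSet_mono inter_subset_left inter_subset_left inter_subset_left)
    obtain ⟨n, hn⟩ := exists_nat_ge (max (max |p.1| |p.2|) |p.1 + p.2|)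
    simp only [max_le_iff] at hn
    exact mem_iUnion.2 ⟨n, ⟨⟨hp.1.1, abs_le.1 hn.1.1⟩, ⟨hp.1.2, abs_le.1 hn.1.2⟩⟩,
      hp.2, abs_le.1 hn.2⟩
  have hmono : Monotone fun n => sumSet (A ∩ K n) (B ∩ K n) (C ∩ K n) := fun m n h =>
    sumSet_mono (inter_subset_inter_right _ (hK h)) (inter_subset_inter_right _ (hK h))
      (inter_subset_inter_right _ (hK h))
  rw [hU, hmono.measure_iUnion]
  have hsub : ∀ {S S' : Set ℝ}, (∀ x ∈ S', ∀ y, |y| ≤ |x| → y ∈ S') → volume S ≤ volume S' →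
      ∀ n, centredIoo (volume (S ∩ K n)).toReal ⊆ S' := fun {S S'} hS' hle n =>
    centredIoo_subset hS' <| by
      rw [ENNReal.ofReal_toReal (hKf S n)]
      exact (measure_mono inter_subset_left).trans hle
  exact iSup_le fun n => (volume_sumSet_le_centredIoo (hA.inter (hKm n)) (hKf A n) (hKf B n)
    (hKf C n)).trans
    (measure_mono (sumSet_mono (hsub hA' hAA' n) (hsub hB' hBB' n) (hsub hC' hCC' n)))
theorem ofReal_eq_lintegral_indicator (a : ℝ) :
    ENNReal.ofReal a = ∫⁻ t in Ioi (0 : ℝ), (Iio a).indicator 1 t := by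
  rw [lintegral_indicator_one measurableSet_Iio, Measure.restrict_apply measurableSet_Iio,
    inter_comm, Ioi_inter_Iio, Real.volume_Ioo, sub_zero]

/-- Layer-cake decomposition of one factor of a product. -/
theorem lintegral_ofReal_mul {Ω : Type*} [MeasurableSpace Ω] (μ : Measure Ω) [SFinite μ]
    {f : Ω → ℝ} {H : Ω → ENNReal} (hf : Measurable f) (hH : Measurable H) :
    ∫⁻ p, ENNReal.ofReal (f p) * H p ∂μ =
      ∫⁻ t in Ioi (0 : ℝ), ∫⁻ p, {p | t < f p}.indicator 1 p * H p ∂μ := by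
  have hm : Measurable fun q : Ω × ℝ => {p | q.2 < f p}.indicator (1 : Ω → ENNReal) q.1 := by
    have : (fun q : Ω × ℝ => {p | q.2 < f p}.indicator (1 : Ω → ENNReal) q.1) =
        {q : Ω × ℝ | q.2 < f q.1}.indicator 1 := rfl
    rw [this]
    exact measurable_one.indicator (measurableSet_lt measurable_snd (hf.comp measurable_fst))
  rw [← lintegral_lintegral_swap (hm.mul (hH.comp measurable_fst)).aemeasurable]
  refine lintegral_congr fun p => ?_
  rw [ofReal_eq_lintegral_indicator]
  exact (lintegral_mul_const _ (hm.comp measurable_prodMk_left)).symm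

theorem lintegral_riesz_eq {f₁ f₂ f₃ : ℝ → ℝ} (hm₁ : Measurable f₁) (hm₂ : Measurable f₂)
    (hm₃ : Measurable f₃) (hn₁ : ∀ x, 0 ≤ f₁ x) (hn₂ : ∀ x, 0 ≤ f₂ x) :
    ∫⁻ x, ∫⁻ y, ENNReal.ofReal (f₁ x * f₂ (x - y) * f₃ y) =
      ∫⁻ t₁ in Ioi (0 : ℝ), ∫⁻ t₂ in Ioi (0 : ℝ), ∫⁻ t₃ in Ioi (0 : ℝ),
        volume (sumSet {x | t₁ < f₁ x} {x | t₂ < f₂ x} {x | t₃ < f₃ x}) := by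
  have hg₁ : Measurable fun p : ℝ × ℝ => f₁ (p.1 + p.2) :=
    hm₁.comp (measurable_fst.add measurable_snd)
  have hg₂ : Measurable fun p : ℝ × ℝ => f₂ p.1 := hm₂.comp measurable_fst
  have hg₃ : Measurable fun p : ℝ × ℝ => f₃ p.2 := hm₃.comp measurable_snd
  have hind : ∀ {f : ℝ × ℝ → ℝ}, Measurable f → ∀ t : ℝ,
      Measurable ({p | t < f p}.indicator (1 : ℝ × ℝ → ENNReal)) := fun hf t =>
    measurable_one.indicator (measurableSet_lt measurable_const hf)
  have hF : Measurable fun p : ℝ × ℝ => ENNReal.ofReal (f₁ p.1 * f₂ (p.1 - p.2) * f₃ p.2) :=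
    (((hm₁.comp measurable_fst).mul (hm₂.comp (measurable_fst.sub measurable_snd))).mul
      hg₃).ennreal_ofReal
  have h0 : ∫⁻ x, ∫⁻ y, ENNReal.ofReal (f₁ x * f₂ (x - y) * f₃ y) =
      ∫⁻ p : ℝ × ℝ, ENNReal.ofReal (f₁ (p.1 + p.2)) *
        (ENNReal.ofReal (f₂ p.1) * ENNReal.ofReal (f₃ p.2)) := by
    rw [← lintegral_prod _ hF.aemeasurable,
      ← (measurePreserving_add_prod (volume : Measure ℝ) (volume : Measure ℝ)).lintegral_comp hF,
      Measure.volume_eq_prod]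
    refine lintegral_congr fun p => ?_
    simp only [add_sub_cancel_right]
    rw [ENNReal.ofReal_mul (mul_nonneg (hn₁ _) (hn₂ _)), ENNReal.ofReal_mul (hn₁ _), mul_assoc]
  rw [h0, lintegral_ofReal_mul _
    (H := fun p : ℝ × ℝ => ENNReal.ofReal (f₂ p.1) * ENNReal.ofReal (f₃ p.2)) hg₁
    (hg₂.ennreal_ofReal.mul hg₃.ennreal_ofReal)]
  refine lintegral_congr fun t₁ => ?_
  simp only [mul_left_comm (indicator _ _ _)]
  rw [lintegral_ofReal_mul _ (H := fun p : ℝ × ℝ =>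
    {p | t₁ < f₁ (p.1 + p.2)}.indicator 1 p * ENNReal.ofReal (f₃ p.2)) hg₂
    ((hind hg₁ t₁).mul hg₃.ennreal_ofReal)]
  refine lintegral_congr fun t₂ => ?_
  simp only [mul_comm (indicator _ _ _) (ENNReal.ofReal _),
    mul_left_comm (indicator _ _ _) (ENNReal.ofReal _)]
  rw [lintegral_ofReal_mul _ (H := fun p : ℝ × ℝ =>
    {p | t₂ < f₂ p.1}.indicator 1 p * {p | t₁ < f₁ (p.1 + p.2)}.indicator 1 p) hg₃
    ((hind hg₂ t₂).mul (hind hg₁ t₁))]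
  refine lintegral_congr fun t₃ => ?_
  rw [← lintegral_indicator_one (measurableSet_sumSet (measurableSet_lt measurable_const hm₁)
    (measurableSet_lt measurable_const hm₂) (measurableSet_lt measurable_const hm₃))]
  refine lintegral_congr fun p => ?_
  simp only [indicator_apply, sumSet, mem_ofPred_eq, Pi.one_apply]
  by_cases h1 : t₁ < f₁ (p.1 + p.2) <;> by_cases h2 : t₂ < f₂ p.1 <;>
    by_cases h3 : t₃ < f₃ p.2 <;> simp [h1, h2, h3]

theorem mem_superlevel_of_abs_le {f : ℝ → ℝ} (he : ∀ x, f (-x) = f x)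
    (ha : AntitoneOn f (Ici 0)) (t : ℝ) : ∀ x ∈ {x | t < f x}, ∀ y, |y| ≤ |x| → y ∈
    {x | t < f x} := by
  intro x hx y hyx
  have habs : ∀ z, f |z| = f z := fun z => by
    rcases abs_choice z with h | h <;> rw [h]
    exact he z
  have := ha (abs_nonneg y) (abs_nonneg x) hyx
  rw [habs, habs] at this
  exact lt_of_lt_of_le hx this

/-- Riesz rearrangement inequality in one dimension:
`∬ f₁(x) f₂(x−y) f₃(y) dx dy ≤ ∬ f₁*(x) f₂*(x−y) f₃*(y) dx dy`
where `fᵢ*` are the symmetric decreasing rearrangements of the `fᵢ`. -/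
theorem stmt4 (f₁ f₂ f₃ fs₁ fs₂ fs₃ : ℝ → ℝ)
    (hm₁ : Measurable f₁) (hm₂ : Measurable f₂) (hm₃ : Measurable f₃)
    (hms₁ : Measurable fs₁) (hms₂ : Measurable fs₂) (hms₃ : Measurable fs₃)
    (hn₁ : ∀ x, 0 ≤ f₁ x) (hn₂ : ∀ x, 0 ≤ f₂ x) (hn₃ : ∀ x, 0 ≤ f₃ x)
    (hns₁ : ∀ x, 0 ≤ fs₁ x) (hns₂ : ∀ x, 0 ≤ fs₂ x) (hns₃ : ∀ x, 0 ≤ fs₃ x)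
    (he₁ : ∀ x, fs₁ (-x) = fs₁ x) (he₂ : ∀ x, fs₂ (-x) = fs₂ x) (he₃ : ∀ x, fs₃ (-x) = fs₃ x)
    (ha₁ : AntitoneOn fs₁ (Ici 0)) (ha₂ : AntitoneOn fs₂ (Ici 0)) (ha₃ : AntitoneOn fs₃ (Ici 0))
    (hl₁ : ∀ t > (0:ℝ), volume {x | t < f₁ x} = volume {x | t < fs₁ x})
    (hl₂ : ∀ t > (0:ℝ), volume {x | t < f₂ x} = volume {x | t < fs₂ x})
    (hl₃ : ∀ t > (0:ℝ), volume {x | t < f₃ x} = volume {x | t < fs₃ x}) :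
    (∫⁻ x, ∫⁻ y, ENNReal.ofReal (f₁ x * f₂ (x - y) * f₃ y)) ≤
      ∫⁻ x, ∫⁻ y, ENNReal.ofReal (fs₁ x * fs₂ (x - y) * fs₃ y) := by
  rw [lintegral_riesz_eq hm₁ hm₂ hm₃ hn₁ hn₂, lintegral_riesz_eq hms₁ hms₂ hms₃ hns₁ hns₂]
  refine setLIntegral_mono' measurableSet_Ioi fun t₁ ht₁ => ?_
  refine setLIntegral_mono' measurableSet_Ioi fun t₂ ht₂ => ?_
  refine setLIntegral_mono' measurableSet_Ioi fun t₃ ht₃ => ?_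
  exact volume_sumSet_le_of_symmetric (measurableSet_lt measurable_const hm₁)
    (mem_superlevel_of_abs_le he₁ ha₁ t₁) (mem_superlevel_of_abs_le he₂ ha₂ t₂)
    (mem_superlevel_of_abs_le he₃ ha₃ t₃) (hl₁ t₁ ht₁).le (hl₂ t₂ ht₂).le (hl₃ t₃ ht₃).le
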